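/- arXiv:1504.06238 — 2 statements merged into one kernel-verified Lean document; each statement's English description precedes it below -/
import Mathlib

section
/- Fix an integer k ≥ 2. Let L_n be the length of the longest directed cycle of the random k-out digraph 𝒟_{n,k} all of whose vertices lie outside the giant 𝒢 (L_n = 0 if there is no such cycle). Then L_n is bounded in probability: for every sequence of reals ω_n → ∞, P(L_n > ω_n) → 0 as n → ∞. -/
open scoped Classical
open Filter MeasureTheory

/-- Probability of an event under the uniform random `k`-out digraph model `𝒟_{n,k}`:
a uniformly random function `f : [n] × [k] → [n]`. -/
noncomputable def prob (n k : ℕ) (P : (Fin n × Fin k → Fin n) → Prop) : ℝ :=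
  ((Finset.univ.filter P).card : ℝ) / (Fintype.card (Fin n × Fin k → Fin n) : ℝ)

/-- One arc step: there is a labeled arc from `u` to `v`. -/
def Step {n k : ℕ} (f : Fin n × Fin k → Fin n) (u v : Fin n) : Prop :=
  ∃ i : Fin k, f (u, i) = v

/-- `u` reaches `v` by following finitely many arcs. -/
def Reaches {n k : ℕ} (f : Fin n × Fin k → Fin n) : Fin n → Fin n → Prop :=
  Relation.ReflTransGen (Step f)

/-- A set of vertices is closed if no arc leaves it. -/
def IsClosedSet {n k : ℕ} (f : Fin n × Fin k → Fin n) (S : Set (Fin n)) : Prop :=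
  ∀ v ∈ S, ∀ i : Fin k, f (v, i) ∈ S

/-- A set of vertices is strongly connected if it is nonempty and
any two of its vertices reach each other. -/
def IsStrConn {n k : ℕ} (f : Fin n × Fin k → Fin n) (S : Set (Fin n)) : Prop :=
  S.Nonempty ∧ ∀ u ∈ S, ∀ v ∈ S, Reaches f u v

/-- `G` is the giant: a closed strongly connected set of maximum size,
ties broken by choosing the one containing the smallest vertex label. -/
def IsGiant {n k : ℕ} (f : Fin n × Fin k → Fin n) (G : Set (Fin n)) : Prop :=
  IsClosedSet f G ∧ IsStrConn f G ∧
    (∀ S : Set (Fin n), IsClosedSet f S → IsStrConn f S → S.ncard ≤ G.ncard) ∧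
    (∀ S : Set (Fin n), IsClosedSet f S → IsStrConn f S → S.ncard = G.ncard →
      ∃ v ∈ G, ∀ u ∈ S, v ≤ u)

/-- Number of directed cycles of length `ℓ` with all vertices in `A`
(cycles are cyclic sequences of distinct vertices, identified up to rotation,
so each cycle corresponds to exactly `ℓ` injective maps `ZMod ℓ → Fin n`). -/
noncomputable def numCycles {n k : ℕ} (f : Fin n × Fin k → Fin n) (A : Set (Fin n)) : ℕ → ℕ
  | 0 => 0
  | (ℓ + 1) =>
      (Finset.univ.filter fun c : ZMod (ℓ + 1) → Fin n =>
        Function.Injective c ∧ (∀ j, c j ∈ A) ∧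
          ∀ j, ∃ i : Fin k, f (c j, i) = c (j + 1)).card / (ℓ + 1)

/-- Every vertex of `B` keeps all its arcs in `B`, and every other vertex has an arc into the
complement of `B`. -/
def IsSeparator {n k : ℕ} (f : Fin n × Fin k → Fin n) (B : Finset (Fin n)) : Prop :=
  (∀ v ∈ B, ∀ i, f (v, i) ∈ B) ∧ ∀ v ∉ B, ∃ i, f (v, i) ∉ B

theorem card_isSeparator {n k : ℕ} (B : Finset (Fin n)) :
    (Finset.univ.filter fun f : Fin n × Fin k → Fin n => IsSeparator f B).card =
      (B.card ^ k) ^ B.card * (n ^ k - B.card ^ k) ^ (n - B.card) := by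
  set S : Finset (Fin k → Fin n) := Fintype.piFinset fun _ => B with hS
  have hmem (g : Fin k → Fin n) : g ∈ S ↔ ∀ i, g i ∈ B := by simp [hS]
  have hcard : S.card = B.card ^ k := by simp [hS]
  have hcompl : Sᶜ.card = n ^ k - B.card ^ k := by
    rw [Finset.card_compl, hcard]; simp
  have key : (Finset.univ.filter fun f : Fin n × Fin k → Fin n => IsSeparator f B).card =
      (Fintype.piFinset fun v : Fin n => if v ∈ B then S else Sᶜ).card := by
    refine Finset.card_bij (fun f _ v i => f (v, i)) ?_ ?_ ?_
    · intro f hf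
      rw [Finset.mem_filter] at hf
      rw [Fintype.mem_piFinset]
      intro v
      by_cases hv : v ∈ B
      · simpa [hv, hmem] using hf.2.1 v hv
      · simpa [hv, hmem] using hf.2.2 v hv
    · intro f _ g _ h
      funext x
      exact congrFun (congrFun h x.1) x.2
    · intro g hg
      rw [Fintype.mem_piFinset] at hg
      refine ⟨fun x => g x.1 x.2, ?_, rfl⟩
      rw [Finset.mem_filter]
      refine ⟨Finset.mem_univ _, fun v hv => ?_, fun v hv => ?_⟩
      · simpa [hv, hmem] using hg v
      · simpa [hv, hmem] using hg v
  rw [key, Fintype.card_piFinset]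
  have hprod : ∀ v : Fin n, (if v ∈ B then S else Sᶜ).card =
      if v ∈ B then B.card ^ k else n ^ k - B.card ^ k := by
    intro v
    split_ifs
    · exact hcard
    · exact hcompl
  simp_rw [hprod]
  rw [Finset.prod_ite, Finset.prod_const, Finset.prod_const]
  congr 2
  · simp
  · rw [← Finset.compl_filter, Finset.card_compl]; simp

theorem prob_isSeparator {n k : ℕ} (hn : 0 < n) (B : Finset (Fin n)) :
    prob n k (fun f => IsSeparator f B) =
      (((B.card : ℝ) / n) ^ k) ^ B.card * (1 - ((B.card : ℝ) / n) ^ k) ^ (n - B.card) := by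
  have hB : B.card ≤ n := by simpa using B.card_le_univ
  have hn0 : (n : ℝ) ≠ 0 := by positivity
  have hpow : B.card ^ k ≤ n ^ k := Nat.pow_le_pow_left hB k
  have htot : (Fintype.card (Fin n × Fin k → Fin n) : ℝ) =
      ((n : ℝ) ^ k) ^ B.card * ((n : ℝ) ^ k) ^ (n - B.card) := by
    rw [← pow_add, Nat.add_sub_cancel' hB, ← pow_mul]
    simp [mul_comm]
  rw [prob, card_isSeparator, htot]
  push_cast [Nat.cast_sub hpow]
  rw [mul_div_mul_comm, ← div_pow, ← div_pow, ← div_pow, sub_div, div_self (pow_ne_zero _ hn0),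
    div_pow (B.card : ℝ) n k]

theorem prob_mono {n k : ℕ} {P Q : (Fin n × Fin k → Fin n) → Prop} (h : ∀ f, P f → Q f) :
    prob n k P ≤ prob n k Q := by
  unfold prob
  refine div_le_div_of_nonneg_right (Nat.cast_le.2 (Finset.card_le_card fun f hf => ?_))
    (Nat.cast_nonneg _)
  simp only [Finset.mem_filter, Finset.mem_univ, true_and] at hf ⊢
  exact h f hf

theorem prob_exists_le_sum {n k : ℕ} {ι : Type*} (s : Finset ι)
    (P : ι → (Fin n × Fin k → Fin n) → Prop) :
    prob n k (fun f => ∃ i ∈ s, P i f) ≤ ∑ i ∈ s, prob n k (P i) := by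
  unfold prob
  rw [← Finset.sum_div]
  refine div_le_div_of_nonneg_right ?_ (Nat.cast_nonneg _)
  rw [← Nat.cast_sum, Nat.cast_le]
  refine (Finset.card_le_card fun f hf => ?_).trans
    (Finset.card_biUnion_le (s := s) (t := fun i => Finset.univ.filter (P i)))
  simpa using hf

theorem exists_isSeparator_of_cycle {n k m : ℕ} {f : Fin n × Fin k → Fin n} {G : Set (Fin n)}
    (hne : G.Nonempty) (hG : IsClosedSet f G) (c : ZMod (m + 1) → Fin n)
    (hinj : Function.Injective c) (hout : ∀ j, c j ∈ Gᶜ)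
    (hstep : ∀ j, ∃ i : Fin k, f (c j, i) = c (j + 1)) :
    ∃ B : Finset (Fin n), B.Nonempty ∧ m + 1 ≤ n - B.card ∧ IsSeparator f B := by
  let A : Finset (Fin n) := Finset.univ.filter fun v => ∃ j, Reaches f v (c j)
  have hA (v : Fin n) : v ∈ A ↔ ∃ j, Reaches f v (c j) := by simp [A]
  have hGreach : ∀ u v, Reaches f u v → u ∈ G → v ∈ G := by
    intro u v h hu
    induction h with
    | refl => exact hu
    | tail _ hs ih => obtain ⟨i, rfl⟩ := hs; exact hG _ ih i
  refine ⟨Aᶜ, ?_, ?_, ?_, ?_⟩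
  · obtain ⟨g, hg⟩ := hne
    refine ⟨g, ?_⟩
    rw [Finset.mem_compl, hA]
    rintro ⟨j, hj⟩
    exact hout j (hGreach _ _ hj hg)
  · have hsub : Finset.univ.image c ⊆ A := by
      intro v hv
      obtain ⟨j, -, rfl⟩ := Finset.mem_image.mp hv
      exact (hA _).2 ⟨j, Relation.ReflTransGen.refl⟩
    have h1 := Finset.card_le_card hsub
    rw [Finset.card_image_of_injective _ hinj, Finset.card_univ, ZMod.card] at h1
    have h2 : A.card ≤ n := by simpa using A.card_le_univ
    rw [Finset.card_compl, Fintype.card_fin]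
    omega
  · intro v hv i
    rw [Finset.mem_compl, hA] at hv ⊢
    rintro ⟨j, hj⟩
    exact hv ⟨j, Relation.ReflTransGen.head ⟨i, rfl⟩ hj⟩
  · intro v hv
    rw [Finset.mem_compl, not_not, hA] at hv
    obtain ⟨j, hj⟩ := hv
    simp only [Finset.mem_compl, not_not, hA]
    rcases Relation.ReflTransGen.cases_head hj with rfl | ⟨w, ⟨i, rfl⟩, hw⟩
    · obtain ⟨i, hi⟩ := hstep j
      exact ⟨i, j + 1, hi ▸ Relation.ReflTransGen.refl⟩
    · exact ⟨i, j, hw⟩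

theorem exists_cycle_of_numCycles_pos {n k m : ℕ} {f : Fin n × Fin k → Fin n}
    {A : Set (Fin n)} (h : 0 < numCycles f A (m + 1)) :
    ∃ c : ZMod (m + 1) → Fin n, Function.Injective c ∧ (∀ j, c j ∈ A) ∧
      ∀ j, ∃ i : Fin k, f (c j, i) = c (j + 1) := by
  unfold numCycles at h
  obtain ⟨c, hc⟩ := Finset.card_pos.1 (Nat.pos_of_div_pos h)
  exact ⟨c, (Finset.mem_filter.1 hc).2⟩

theorem exists_isSeparator_of_longest_cycle {n k : ℕ} {f : Fin n × Fin k → Fin n}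
    {G : Set (Fin n)} (hne : G.Nonempty) (hG : IsClosedSet f G) {w : ℝ} (hw : 0 ≤ w)
    (h : w < ((sSup {ℓ : ℕ | 1 ≤ numCycles f Gᶜ ℓ} : ℕ) : ℝ)) :
    ∃ B : Finset (Fin n), B.Nonempty ∧ w < ((n - B.card : ℕ) : ℝ) ∧ IsSeparator f B := by
  set S : Set ℕ := {ℓ : ℕ | 1 ≤ numCycles f Gᶜ ℓ} with hS
  obtain ⟨ℓ, hℓ, hlt⟩ : ∃ ℓ ∈ S, w < (ℓ : ℝ) := by
    by_contra! hle
    have : sSup S ≤ ⌊w⌋₊ := csSup_le' fun ℓ hℓ => Nat.le_floor (hle ℓ hℓ)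
    exact absurd h (not_lt.2 ((Nat.le_floor_iff hw).1 this))
  cases ℓ with
  | zero => simp [hS, numCycles] at hℓ
  | succ m =>
    obtain ⟨c, hinj, hout, hstep⟩ := exists_cycle_of_numCycles_pos hℓ
    obtain ⟨B, hB, hcard, hsep⟩ := exists_isSeparator_of_cycle hne hG c hinj hout hstep
    exact ⟨B, hB, hlt.trans_le (by exact_mod_cast hcard), hsep⟩

/-- Monotonicity in `q` of the likelihood `q ^ b * (1 - q) ^ a` below its mode. -/
theorem pow_mul_one_sub_pow_le {p q : ℝ} {a b : ℕ} (hq : 0 ≤ q) (hqp : q ≤ p) (hp0 : 0 < p)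
    (hp1 : p < 1) (hp : p * (a + b) ≤ b) :
    q ^ b * (1 - q) ^ a ≤ p ^ b * (1 - p) ^ a := by
  have h1 : 0 < 1 - p := by linarith
  have e1 : (q / p) ^ b ≤ Real.exp (b * (q / p - 1)) := by
    rw [Real.exp_nat_mul]
    exact pow_le_pow_left₀ (by positivity) (by linarith [Real.add_one_le_exp (q / p - 1)]) _
  have e2 : ((1 - q) / (1 - p)) ^ a ≤ Real.exp (a * ((1 - q) / (1 - p) - 1)) := by
    rw [Real.exp_nat_mul]
    exact pow_le_pow_left₀ (div_nonneg (by linarith) h1.le)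
      (by linarith [Real.add_one_le_exp ((1 - q) / (1 - p) - 1)]) _
  have hexp : (b * (q / p - 1) + a * ((1 - q) / (1 - p) - 1) : ℝ) ≤ 0 := by
    have : (b * (q / p - 1) + a * ((1 - q) / (1 - p) - 1) : ℝ) =
        -((p - q) * (b - p * (a + b)) / (p * (1 - p))) := by
      field_simp
      ring
    rw [this, neg_nonpos]
    exact div_nonneg (mul_nonneg (by linarith) (by linarith)) (by positivity)
  have hle : (q / p) ^ b * ((1 - q) / (1 - p)) ^ a ≤ 1 := by
    calc _ ≤ Real.exp (b * (q / p - 1)) * Real.exp (a * ((1 - q) / (1 - p) - 1)) :=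
          mul_le_mul e1 e2 (pow_nonneg (div_nonneg (by linarith) h1.le) _) (Real.exp_pos _).le
      _ ≤ 1 := by rw [← Real.exp_add]; exact Real.exp_le_one_iff.2 hexp
  rw [div_pow, div_pow, div_mul_div_comm, div_le_one (by positivity)] at hle
  exact hle

theorem choose_mul_pow_le_one {n b : ℕ} (hb : b ≤ n) {x : ℝ} (h0 : 0 ≤ x) (h1 : x ≤ 1) :
    (n.choose b : ℝ) * (x ^ b * (1 - x) ^ (n - b)) ≤ 1 := by
  have h := add_pow x (1 - x) n
  rw [add_sub_cancel, one_pow] at h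
  refine le_of_le_of_eq ?_ h.symm
  have := Finset.single_le_sum (f := fun m => x ^ m * (1 - x) ^ (n - m) * (n.choose m : ℝ))
    (s := Finset.range (n + 1)) (fun m _ => by
      have : 0 ≤ 1 - x := by linarith
      positivity) (Finset.mem_range.2 (by omega : b < n + 1))
  simpa [mul_comm] using this

theorem choose_mul_separator_le_exp {n b k : ℕ} (hk : 2 ≤ k) (hb : 0 < b) (hbn : b < n) :
    (n.choose b : ℝ) * ((((b : ℝ) / n) ^ k) ^ b * (1 - ((b : ℝ) / n) ^ k) ^ (n - b)) ≤
      Real.exp (b * Real.log ((b : ℝ) / n) + (n - b : ℕ) * Real.log (1 + (b : ℝ) / n)) := by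
  have hn : (0 : ℝ) < n := by exact_mod_cast hb.trans hbn
  have hb' : (0 : ℝ) < b := by exact_mod_cast hb
  set x : ℝ := (b : ℝ) / n with hx
  have hx0 : 0 < x := by positivity
  have hx1 : x < 1 := by rw [hx, div_lt_one hn]; exact_mod_cast hbn
  have hxn : x * n = b := by rw [hx]; field_simp
  have hmono := pow_mul_one_sub_pow_le (a := n - b) (b := b) (pow_nonneg hx0.le k)
    (pow_le_pow_of_le_one hx0.le hx1.le hk) (by positivity) (by nlinarith) (by
      rw [Nat.cast_sub hbn.le, sub_add_cancel]
      nlinarith)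
  calc _ ≤ (n.choose b : ℝ) * ((x ^ 2) ^ b * (1 - x ^ 2) ^ (n - b)) := by gcongr
    _ = ((n.choose b : ℝ) * (x ^ b * (1 - x) ^ (n - b))) * (x ^ b * (1 + x) ^ (n - b)) := by
        rw [show 1 - x ^ 2 = (1 - x) * (1 + x) by ring, mul_pow, pow_two, mul_pow]
        ring
    _ ≤ 1 * (x ^ b * (1 + x) ^ (n - b)) := by
        gcongr
        exact choose_mul_pow_le_one hbn.le hx0.le hx1.le
    _ = _ := by
        rw [Real.exp_add, Real.exp_nat_mul, Real.exp_nat_mul, Real.exp_log hx0,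
          Real.exp_log (by linarith), one_mul]

theorem mul_log_add_mul_log_le {a b n x : ℝ} (ha : 0 ≤ a) (hn : 0 < n) (hab : a + b = n)
    (hx0 : 0 < x) (hx : x * n = b) :
    b * Real.log x + a * Real.log (1 + x) ≤ b * (Real.log x + 1) := by
  have h1 : Real.log (1 + x) ≤ x := by
    linarith [Real.log_le_sub_one_of_pos (show 0 < 1 + x by linarith)]
  have h2 : a * Real.log (1 + x) ≤ a * x := by gcongr
  nlinarith [mul_pos hx0 hx0]

theorem mul_log_add_mul_log_le_of_le_half {a b n x : ℝ} (ha : 0 ≤ a) (hn : 0 < n)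
    (hab : a + b = n) (hx0 : 0 < x) (hx : x * n = b) (hx2 : x ≤ 1 / 2) :
    b * Real.log x + a * Real.log (1 + x) ≤ -(b / 20) := by
  have hb : 0 < b := hx ▸ mul_pos hx0 hn
  have h1 : Real.log (1 + x) ≤ x := by
    linarith [Real.log_le_sub_one_of_pos (show 0 < 1 + x by linarith)]
  have h2 : a * Real.log (1 + x) ≤ a * x := by gcongr
  have h3 : a * x = b * (1 - x) := by rw [← hx]; nlinarith
  have h4 : Real.log x ≤ 2 * x - 1 - Real.log 2 := by
    have := Real.log_le_sub_one_of_pos (show 0 < 2 * x by linarith)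
    rw [Real.log_mul (by norm_num) hx0.ne'] at this
    linarith
  have h5 : Real.log x + (1 - x) ≤ -(1 / 20) := by linarith [Real.log_two_gt_d9]
  nlinarith

theorem mul_log_add_mul_log_le_of_half_le {a b n x : ℝ} (ha : 0 ≤ a) (hn : 0 < n)
    (hab : a + b = n) (hx0 : 0 < x) (hx : x * n = b) (hx2 : 1 / 2 ≤ x) :
    b * Real.log x + a * Real.log (1 + x) ≤ -(a / 20) := by
  have hb : 0 < b := hx ▸ mul_pos hx0 hn
  have h1 : Real.log (1 + x) ≤ Real.log 2 + (x - 1) / 2 := by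
    have := Real.log_le_sub_one_of_pos (show 0 < (1 + x) / 2 by linarith)
    rw [Real.log_div (by linarith) (by norm_num)] at this
    linarith
  have h2 : a * Real.log (1 + x) ≤ a * (Real.log 2 + (x - 1) / 2) := by gcongr
  have h3 : b * Real.log x ≤ b * (x - 1) := by
    gcongr
    exact Real.log_le_sub_one_of_pos hx0
  have h4 : b * (x - 1) = -(a * x) := by
    have : a = n * (1 - x) := by linarith
    rw [this, ← hx]; ring
  have h5 : Real.log 2 + (x - 1) / 2 - x ≤ -(1 / 20) := by linarith [Real.log_two_lt_d9]
  nlinarith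

/-- Bound for the expected number of separators of size `b`, used when `2 * b ≤ n`. -/
noncomputable def smallBound (n b : ℕ) : ℝ :=
  if 0 < b then
    min (Real.exp (-((b : ℝ) / 20))) (Real.exp (b * (Real.log ((b : ℝ) / n) + 1))) else 0

/-- Bound for the expected number of separators with complement of size `a > w`, used when
`2 * a ≤ n`. -/
noncomputable def largeBound (w : ℝ) (a : ℕ) : ℝ :=
  if w < a then Real.exp (-((a : ℝ) / 20)) else 0

theorem smallBound_nonneg (n b : ℕ) : 0 ≤ smallBound n b := by
  unfold smallBound; split_ifs <;> positivity

theorem largeBound_nonneg (w : ℝ) (a : ℕ) : 0 ≤ largeBound w a := by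
  unfold largeBound; split_ifs <;> positivity

theorem smallBound_le (n b : ℕ) : smallBound n b ≤ Real.exp (-((b : ℝ) / 20)) := by
  unfold smallBound
  split_ifs
  · exact min_le_left _ _
  · positivity

theorem largeBound_le (w : ℝ) (a : ℕ) : largeBound w a ≤ Real.exp (-((a : ℝ) / 20)) := by
  unfold largeBound; split_ifs
  · exact le_rfl
  · positivity

theorem summable_exp_neg_div : Summable fun b : ℕ => Real.exp (-((b : ℝ) / 20)) := by
  have := Real.summable_exp_nat_mul_iff.2 (show (-(1 / 20) : ℝ) < 0 by norm_num)
  refine this.congr fun b => ?_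
  congr 1
  ring

theorem choose_mul_separator_le_bounds {n b k : ℕ} {w : ℝ} (hk : 2 ≤ k) (hb : 0 < b)
    (hbn : b < n) (hw : w < ((n - b : ℕ) : ℝ)) :
    (n.choose b : ℝ) * ((((b : ℝ) / n) ^ k) ^ b * (1 - ((b : ℝ) / n) ^ k) ^ (n - b)) ≤
      smallBound n b + largeBound w (n - b) := by
  have hn : (0 : ℝ) < n := by exact_mod_cast hb.trans hbn
  have hb' : (0 : ℝ) < b := by exact_mod_cast hb
  have hx0 : 0 < (b : ℝ) / n := by positivity
  have hxn : (b : ℝ) / n * n = b := by field_simp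
  have hab : ((n - b : ℕ) : ℝ) + b = n := by rw [Nat.cast_sub hbn.le]; ring
  refine (choose_mul_separator_le_exp hk hb hbn).trans ?_
  rcases le_total ((b : ℝ) / n) (1 / 2) with h | h
  · refine le_trans ?_ (le_add_of_nonneg_right (largeBound_nonneg _ _))
    rw [smallBound, if_pos hb]
    exact le_min
      (Real.exp_le_exp.2 (mul_log_add_mul_log_le_of_le_half (Nat.cast_nonneg _) hn hab hx0 hxn h))
      (Real.exp_le_exp.2 (mul_log_add_mul_log_le (Nat.cast_nonneg _) hn hab hx0 hxn))
  · refine le_trans ?_ (le_add_of_nonneg_left (smallBound_nonneg _ _))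
    rw [largeBound, if_pos hw]
    exact Real.exp_le_exp.2
      (mul_log_add_mul_log_le_of_half_le (Nat.cast_nonneg _) hn hab hx0 hxn h)

theorem tendsto_tsum_smallBound : Tendsto (fun n => ∑' b, smallBound n b) atTop (nhds 0) := by
  have h : Tendsto (fun n => ∑' b, smallBound n b) atTop (nhds (∑' _ : ℕ, (0 : ℝ))) := by
    refine tendsto_tsum_of_dominated_convergence summable_exp_neg_div (fun b => ?_)
      (Eventually.of_forall fun n b => ?_)
    · rcases Nat.eq_zero_or_pos b with rfl | hb
      · simp [smallBound]
      have hb' : (0 : ℝ) < b := by exact_mod_cast hb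
      have hlim : Tendsto (fun n : ℕ => Real.exp (b * (Real.log ((b : ℝ) / n) + 1))) atTop
          (nhds 0) := by
        have h0 : Tendsto (fun n : ℕ => (b : ℝ) / n) atTop (nhdsWithin 0 (Set.Ioi 0)) :=
          tendsto_nhdsWithin_iff.2 ⟨tendsto_const_div_atTop_nhds_zero_nat _,
            (eventually_gt_atTop 0).mono fun n hn => by
              have : (0 : ℝ) < n := by exact_mod_cast hn
              exact div_pos hb' this⟩
        exact Real.tendsto_exp_atBot.comp ((tendsto_atBot_add_const_right _ _
          (Real.tendsto_log_nhdsGT_zero.comp h0)).const_mul_atBot hb')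
      refine squeeze_zero (fun n => smallBound_nonneg n b) (fun n => ?_) hlim
      rw [smallBound, if_pos hb]
      exact min_le_right _ _
    · rw [Real.norm_of_nonneg (smallBound_nonneg _ _)]
      exact smallBound_le n b
  simpa using h

theorem tendsto_tsum_largeBound {ω : ℕ → ℝ} (hω : Tendsto ω atTop atTop) :
    Tendsto (fun n => ∑' a, largeBound (ω n) a) atTop (nhds 0) := by
  have h : Tendsto (fun n => ∑' a, largeBound (ω n) a) atTop (nhds (∑' _ : ℕ, (0 : ℝ))) := by
    refine tendsto_tsum_of_dominated_convergence summable_exp_neg_div (fun a => ?_)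
      (Eventually.of_forall fun n a => ?_)
    · refine tendsto_const_nhds.congr' ?_
      filter_upwards [hω.eventually_ge_atTop (a : ℝ)] with n hn
      rw [largeBound, if_neg (not_lt.2 hn)]
    · rw [Real.norm_of_nonneg (largeBound_nonneg _ _)]
      exact largeBound_le _ a
  simpa using h

theorem sum_range_bounds_le_tsum (n : ℕ) (w : ℝ) :
    ∑ b ∈ Finset.range (n + 1), (smallBound n b + largeBound w (n - b)) ≤
      ∑' b, smallBound n b + ∑' a, largeBound w a := by
  have h1 : Summable (smallBound n) :=
    summable_exp_neg_div.of_nonneg_of_le (smallBound_nonneg n) (smallBound_le n)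
  have h2 : Summable (largeBound w) :=
    summable_exp_neg_div.of_nonneg_of_le (largeBound_nonneg w) (largeBound_le w)
  rw [Finset.sum_add_distrib]
  refine add_le_add (h1.sum_le_tsum _ fun b _ => smallBound_nonneg n b) ?_
  have := Finset.sum_range_reflect (largeBound w) (n + 1)
  simp only [Nat.add_sub_cancel] at this
  rw [this]
  exact h2.sum_le_tsum _ fun b _ => largeBound_nonneg w b

theorem prob_longest_cycle_le {n k : ℕ} (hk : 2 ≤ k) {w : ℝ} (hw : 0 ≤ w) :
    prob n k (fun f => ∃ G : Set (Fin n), IsGiant f G ∧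
        w < ((sSup {ℓ : ℕ | 1 ≤ numCycles f Gᶜ ℓ} : ℕ) : ℝ)) ≤
      ∑' b, smallBound n b + ∑' a, largeBound w a := by
  let s : Finset (Finset (Fin n)) :=
    Finset.univ.filter fun B => 0 < B.card ∧ w < ((n - B.card : ℕ) : ℝ)
  have hmono : prob n k (fun f => ∃ G : Set (Fin n), IsGiant f G ∧
        w < ((sSup {ℓ : ℕ | 1 ≤ numCycles f Gᶜ ℓ} : ℕ) : ℝ)) ≤
      prob n k (fun f => ∃ B ∈ s, IsSeparator f B) := by
    refine prob_mono ?_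
    rintro f ⟨G, hG, hlt⟩
    obtain ⟨B, hB, hcard, hsep⟩ :=
      exists_isSeparator_of_longest_cycle hG.2.1.1 hG.1 hw hlt
    exact ⟨B, by simpa [s] using ⟨hB, hcard⟩, hsep⟩
  refine (hmono.trans (prob_exists_le_sum s fun B f => IsSeparator f B)).trans ?_
  refine le_trans ?_ (sum_range_bounds_le_tsum n w)
  let g : ℕ → ℝ := fun b => if 0 < b ∧ w < ((n - b : ℕ) : ℝ) then
    (((b : ℝ) / n) ^ k) ^ b * (1 - ((b : ℝ) / n) ^ k) ^ (n - b) else 0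
  have hsum : ∑ B ∈ s, prob n k (fun f => IsSeparator f B) =
      ∑ B ∈ (Finset.univ : Finset (Fin n)).powerset, g B.card := by
    rw [Finset.powerset_univ, Finset.sum_filter]
    refine Finset.sum_congr rfl fun B _ => ?_
    simp only [g]
    split_ifs with h
    · have hB : B.card ≤ n := by simpa using B.card_le_univ
      exact prob_isSeparator (by omega) B
    · rfl
  rw [hsum, Finset.sum_powerset_apply_card, Finset.card_univ, Fintype.card_fin]
  refine Finset.sum_le_sum fun b _ => ?_
  rw [nsmul_eq_mul]
  simp only [g]
  split_ifs with h
  · have hbn : 0 < n - b := by exact_mod_cast hw.trans_lt h.2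
    exact choose_mul_separator_le_bounds hk h.1 (by omega) h.2
  · rw [mul_zero]
    exact add_nonneg (smallBound_nonneg _ _) (largeBound_nonneg _ _)

/-- The length `L_n` of the longest cycle of `𝒟_{n,k}` lying entirely outside the giant
(`0` if there is none) is bounded in probability: `P(L_n > ω_n) → 0`
for every sequence `ω_n → ∞`. -/
theorem longest_cycle_outside_giant_Op_one (k : ℕ) (hk : 2 ≤ k)
    (ω : ℕ → ℝ) (hω : Filter.Tendsto ω Filter.atTop Filter.atTop) :
    Filter.Tendsto (fun n : ℕ =>
      prob n k (fun f => ∃ G : Set (Fin n), IsGiant f G ∧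
        ω n < ((sSup {ℓ : ℕ | 1 ≤ numCycles f Gᶜ ℓ} : ℕ) : ℝ)))
      Filter.atTop (nhds 0) := by
  have hlim := tendsto_tsum_smallBound.add (tendsto_tsum_largeBound hω)
  rw [add_zero] at hlim
  refine squeeze_zero' (Eventually.of_forall fun n => by unfold prob; positivity) ?_ hlim
  filter_upwards [hω.eventually_ge_atTop 0] with n hn
  exact prob_longest_cycle_le hk hn
end

section
/- Fix an integer k ≥ 2. In the random k-out digraph 𝒟_{n,k}, for v outside the giant 𝒢 let Q*(v) denote the set of vertices reachable from v using only vertices outside 𝒢. Then with probability tending to 1 as n → ∞, for every vertex v outside 𝒢, the number of arcs of the subdigraph induced by Q*(v) is at most |Q*(v)|; i.e. P(∃ v ∉ 𝒢 with arc(𝒟[Q*(v)]) − |Q*(v)| ≥ 1) → 0. (Equivalently, whp every such spectrum induces a tree or a tree plus one extra arc.) -/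
open scoped Classical
open Filter MeasureTheory

/-- Reachability using only vertices of `A` (every vertex along the way lies in `A`). -/
def ReachesIn {n k : ℕ} (f : Fin n × Fin k → Fin n) (A : Set (Fin n)) :
    Fin n → Fin n → Prop :=
  Relation.ReflTransGen (fun u v => u ∈ A ∧ v ∈ A ∧ ∃ i : Fin k, f (u, i) = v)

/-- `Q*(v)`: the set of vertices reachable from `v` using only vertices of `A`. -/
def specIn {n k : ℕ} (f : Fin n × Fin k → Fin n) (A : Set (Fin n)) (v : Fin n) :
    Set (Fin n) :=
  {u ∈ A | ReachesIn f A v u}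

/-- The number of labeled arcs of the subdigraph induced by `A`. -/
noncomputable def numArcs {n k : ℕ} (f : Fin n × Fin k → Fin n) (A : Set (Fin n)) : ℕ :=
  (Finset.univ.filter fun p : Fin n × Fin k => p.1 ∈ A ∧ f p ∈ A).card

/-- Overriding coordinates along an embedding: the uniform measure of a cylinder event. -/
theorem card_comp_mem_mul_le {ι σ V : Type*} [Fintype ι] [Fintype σ] [Fintype V]
    [DecidableEq ι] [DecidableEq σ]
    (e : ι ↪ σ) (H : Finset (ι → V)) :
    (Finset.univ.filter fun f : σ → V => f ∘ e ∈ H).card * Fintype.card (ι → V) ≤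
      Fintype.card (σ → V) * H.card := by
  rw [← Finset.card_univ, ← Finset.card_univ, ← Finset.card_product, ← Finset.card_product]
  refine Finset.card_le_card_of_injOn (fun x => (Function.extend e x.2 x.1, x.1 ∘ e)) ?_ ?_
  · rintro ⟨f, z⟩ h
    simpa using h
  · rintro ⟨f, z⟩ - ⟨f', z'⟩ - h
    simp only [Prod.mk.injEq] at h ⊢
    obtain ⟨h1, h2⟩ := h
    refine ⟨funext fun s => ?_, funext fun i => ?_⟩
    · by_cases hs : ∃ i, e i = s
      · obtain ⟨i, rfl⟩ := hs
        exact congrFun h2 i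
      · have := congrFun h1 s
        rwa [Function.extend_apply' _ _ _ hs, Function.extend_apply' _ _ _ hs] at this
    · have := congrFun h1 (e i)
      rwa [e.injective.extend_apply, e.injective.extend_apply] at this

/-- Events depending on disjoint sets of coordinates are independent. -/
theorem card_filter_and_mul_card {σ V : Type*} [Fintype σ] [Fintype V] [DecidableEq σ]
    (T : Finset σ) (p r : (σ → V) → Prop)
    (hp : ∀ f f', (∀ s ∈ T, f s = f' s) → p f → p f')
    (hr : ∀ f f', (∀ s ∉ T, f s = f' s) → r f → r f') :
    (Finset.univ.filter fun f => p f ∧ r f).card * Fintype.card (σ → V) =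
      (Finset.univ.filter p).card * (Finset.univ.filter r).card := by
  rw [← Finset.card_univ, ← Finset.card_product, ← Finset.card_product]
  refine Finset.card_nbij' (fun x => (T.piecewise x.1 x.2, T.piecewise x.2 x.1))
    (fun x => (T.piecewise x.1 x.2, T.piecewise x.2 x.1)) ?_ ?_ ?_ ?_
  · rintro ⟨f, g⟩ h
    simp only [Finset.coe_product, Set.mem_prod, Finset.mem_coe, Finset.mem_filter,
      Finset.mem_univ, true_and, and_true] at h ⊢
    exact ⟨hp f _ (fun s hs => by simp [hs]) h.1, hr f _ (fun s hs => by simp [hs]) h.2⟩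
  · rintro ⟨f, g⟩ h
    simp only [Finset.coe_product, Set.mem_prod, Finset.mem_coe, Finset.mem_filter,
      Finset.mem_univ, true_and, and_true] at h ⊢
    exact ⟨hp f _ (fun s hs => by simp [hs]) h.1, hr g _ (fun s hs => by simp [hs]) h.2⟩
  · rintro ⟨f, g⟩ -
    ext s <;> by_cases hs : s ∈ T <;> simp [hs]
  · rintro ⟨f, g⟩ -
    ext s <;> by_cases hs : s ∈ T <;> simp [hs]

/-- The number of functions `Fin m → Fin n` whose image has exactly `g` elements. -/
noncomputable def occCount (n m g : ℕ) : ℕ :=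
  (Finset.univ.filter fun h : Fin m → Fin n => (Finset.univ.image h).card = g).card

theorem sum_pow_card_compl_image_le (n m : ℕ) (hn : 1 ≤ n) (t : ℝ) (ht : 1 ≤ t) :
    ∑ h : Fin m → Fin n, t ^ (Finset.univ.image h)ᶜ.card ≤
      (n : ℝ) ^ m * (1 + (t - 1) * Real.exp (-(m / n : ℝ))) ^ n := by
  have hn0 : (0 : ℝ) < n := by exact_mod_cast hn
  have expand : ∀ h : Fin m → Fin n, t ^ (Finset.univ.image h)ᶜ.card =
      ∑ J : Finset (Fin n), if J ⊆ (Finset.univ.image h)ᶜ then (t - 1) ^ J.card else 0 := by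
    intro h
    have := Finset.sum_pow_mul_eq_add_pow (t - 1) 1 (Finset.univ.image h)ᶜ
    simp only [one_pow, mul_one, sub_add_cancel] at this
    rw [← this, ← Finset.sum_filter]
    refine Finset.sum_congr ?_ fun _ _ => rfl
    ext J
    simp
  have avoid : ∀ J : Finset (Fin n),
      (Finset.univ.filter fun h : Fin m → Fin n => J ⊆ (Finset.univ.image h)ᶜ).card =
        (n - J.card) ^ m := by
    intro J
    have : (Finset.univ.filter fun h : Fin m → Fin n => J ⊆ (Finset.univ.image h)ᶜ) =
        Fintype.piFinset fun _ => Jᶜ := by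
      ext h
      simp only [Finset.mem_filter, Finset.mem_univ, true_and, Fintype.mem_piFinset,
        Finset.mem_compl, Finset.subset_iff, Finset.mem_image, not_exists]
      exact ⟨fun H a ha => H ha a rfl, fun H x hx a ha => H a (ha ▸ hx)⟩
    rw [this, Fintype.card_piFinset]
    simp [Finset.card_compl]
  simp_rw [expand]
  rw [Finset.sum_comm]
  have key : ∀ J : Finset (Fin n),
      (∑ h : Fin m → Fin n, if J ⊆ (Finset.univ.image h)ᶜ then (t - 1) ^ J.card else 0) ≤
        (n : ℝ) ^ m * ((t - 1) * Real.exp (-(m / n : ℝ))) ^ J.card := by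
    intro J
    have hJ : J.card ≤ n := by simpa using Finset.card_le_univ J
    rw [← Finset.sum_filter, Finset.sum_const, avoid, nsmul_eq_mul, Nat.cast_pow,
      Nat.cast_sub hJ, mul_pow, ← Real.exp_nat_mul]
    have h1 : ((n : ℝ) - J.card) ≤ n * Real.exp (-(J.card / n : ℝ)) := by
      have := Real.add_one_le_exp (-(J.card / n : ℝ))
      calc ((n : ℝ) - J.card) = n * (-(J.card / n : ℝ) + 1) := by field_simp; ring
        _ ≤ _ := by gcongr
    have h0 : (0 : ℝ) ≤ (n : ℝ) - J.card := by
      have : (J.card : ℝ) ≤ n := by exact_mod_cast hJ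
      linarith
    calc ((n : ℝ) - J.card) ^ m * (t - 1) ^ J.card
        ≤ (n * Real.exp (-(J.card / n : ℝ))) ^ m * (t - 1) ^ J.card := by
          have : 0 ≤ t - 1 := by linarith
          gcongr
      _ = _ := by
          rw [mul_pow, ← Real.exp_nat_mul]
          have : (m : ℝ) * -(J.card / n : ℝ) = J.card * -(m / n : ℝ) := by ring
          rw [this]; ring
  refine (Finset.sum_le_sum fun J _ => key J).trans ?_
  rw [← Finset.mul_sum]
  have := Finset.sum_pow_mul_eq_add_pow ((t - 1) * Real.exp (-(m / n : ℝ))) 1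
    (Finset.univ : Finset (Fin n))
  simp only [one_pow, mul_one, Finset.powerset_univ, Finset.card_univ, Fintype.card_fin] at this
  rw [this, add_comm]

/-- Chernoff bound for the number of occupied boxes. -/
theorem occCount_div_le (n m g : ℕ) (hn : 1 ≤ n) (hg : g ≤ n) (η : ℝ) (hη : 0 ≤ η)
    (h : (1 + η) * g ≤ n * (1 - Real.exp (-(m / n : ℝ)))) :
    (occCount n m g : ℝ) / (n : ℝ) ^ m ≤ ((1 + η) * Real.exp (-η)) ^ g := by
  have hn0 : (0 : ℝ) < n := by exact_mod_cast hn
  set p := Real.exp (-(m / n : ℝ)) with hp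
  have hp0 : 0 < p := Real.exp_pos _
  have hη1 : 0 < 1 + η := by linarith
  have h1 : (occCount n m g : ℝ) * (1 + η) ^ (n - g) ≤
      (n : ℝ) ^ m * (1 + η * p) ^ n := by
    have h2 := sum_pow_card_compl_image_le n m hn (1 + η) (by linarith)
    rw [add_sub_cancel_left] at h2
    refine le_trans ?_ h2
    rw [occCount, ← nsmul_eq_mul, ← Finset.sum_const]
    calc _ = ∑ x : Fin m → Fin n with (Finset.univ.image x).card = g,
          (1 + η) ^ (Finset.univ.image x)ᶜ.card := by
          refine Finset.sum_congr rfl fun x hx => ?_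
          rw [Finset.card_compl, (Finset.mem_filter.mp hx).2, Fintype.card_fin]
      _ ≤ _ := Finset.sum_le_sum_of_subset_of_nonneg (Finset.filter_subset _ _)
          fun _ _ _ => by positivity
  rw [div_le_iff₀ (by positivity)]
  have h3 : (1 + η * p) ≤ (1 + η) * Real.exp (-(η / (1 + η) * (1 - p))) := by
    have := Real.add_one_le_exp (-(η / (1 + η) * (1 - p)))
    calc (1 + η * p) = (1 + η) * (-(η / (1 + η) * (1 - p)) + 1) := by field_simp; ring
      _ ≤ _ := by gcongr
  have h4 : (1 + η * p) ^ n ≤ (1 + η) ^ n * Real.exp (-η) ^ g := by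
    calc (1 + η * p) ^ n ≤ ((1 + η) * Real.exp (-(η / (1 + η) * (1 - p)))) ^ n := by gcongr
      _ = (1 + η) ^ n * Real.exp (n * -(η / (1 + η) * (1 - p))) := by
          rw [mul_pow, ← Real.exp_nat_mul]
      _ ≤ (1 + η) ^ n * Real.exp (g * -η) := by
          refine mul_le_mul_of_nonneg_left (Real.exp_le_exp.mpr ?_) (by positivity)
          have : (η / (1 + η)) * ((1 + η) * g) ≤ (η / (1 + η)) * (n * (1 - p)) := by gcongr
          have e : (η / (1 + η)) * ((1 + η) * g) = η * g := by field_simp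
          linarith
      _ = _ := by rw [← Real.exp_nat_mul]
  have h5 : (1 + η) ^ n = (1 + η) ^ g * (1 + η) ^ (n - g) := by
    rw [← pow_add]; congr 1; omega
  have h6 : (0 : ℝ) < (1 + η) ^ (n - g) := by positivity
  refine le_of_mul_le_mul_right ?_ h6
  calc _ ≤ (n : ℝ) ^ m * (1 + η * p) ^ n := h1
    _ ≤ (n : ℝ) ^ m * ((1 + η) ^ n * Real.exp (-η) ^ g) := by gcongr
    _ = _ := by rw [h5, mul_pow]; ring

theorem occCount_le_choose_mul (n m g : ℕ) : occCount n m g ≤ n.choose g * g ^ m := by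
  have hsub : (Finset.univ.filter fun h : Fin m → Fin n => (Finset.univ.image h).card = g) ⊆
      (Finset.powersetCard g Finset.univ).biUnion
        fun S : Finset (Fin n) => Fintype.piFinset fun _ => S := by
    intro h hh
    simp only [Finset.mem_filter, Finset.mem_univ, true_and] at hh
    simp only [Finset.mem_biUnion, Finset.mem_powersetCard, Fintype.mem_piFinset]
    exact ⟨_, ⟨Finset.subset_univ _, hh⟩, fun a => Finset.mem_image_of_mem _ (Finset.mem_univ a)⟩
  refine (Finset.card_le_card hsub).trans (Finset.card_biUnion_le.trans ?_)
  rw [Finset.sum_congr rfl (g := fun _ => g ^ m)]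
  · simp
  · intro S hS
    rw [Fintype.card_piFinset]
    simp [(Finset.mem_powersetCard.mp hS).2]

theorem tendsto_occCount_div (k g : ℕ) (hk : 2 ≤ k) (hg : 1 ≤ g) :
    Tendsto (fun n : ℕ => (occCount n (g * k) g : ℝ) / (n : ℝ) ^ (g * k)) atTop (nhds 0) := by
  have lim : Tendsto (fun n : ℕ => (g : ℝ) ^ (g * k) * ((n : ℝ)⁻¹)) atTop (nhds 0) := by
    simpa using (tendsto_inv_atTop_nhds_zero_nat (𝕜 := ℝ)).const_mul ((g : ℝ) ^ (g * k))
  refine squeeze_zero' (Eventually.of_forall fun n => by positivity) ?_ lim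
  filter_upwards [eventually_ge_atTop 1] with n hn
  have hn0 : (0 : ℝ) < n := by exact_mod_cast hn
  have hn1 : (1 : ℝ) ≤ n := by exact_mod_cast hn
  have h1 : (occCount n (g * k) g : ℝ) ≤ (n : ℝ) ^ g * (g : ℝ) ^ (g * k) := by
    have := (occCount_le_choose_mul n (g * k) g).trans
      (Nat.mul_le_mul_right _ (Nat.choose_le_pow n g))
    exact_mod_cast this
  have h2 : (n : ℝ) ^ g * n ≤ (n : ℝ) ^ (g * k) := by
    rw [← pow_succ]
    exact pow_le_pow_right₀ hn1 (by nlinarith)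
  rw [div_le_iff₀ (by positivity)]
  calc _ ≤ (n : ℝ) ^ g * (g : ℝ) ^ (g * k) := h1
    _ = (g : ℝ) ^ (g * k) * (n : ℝ)⁻¹ * ((n : ℝ) ^ g * n) := by field_simp
    _ ≤ _ := by gcongr

/-- Some closed set of size `g` has all its vertices hit by its own arcs. -/
theorem card_exists_image_eq_mul_le (n k g : ℕ) :
    (Finset.univ.filter fun f : Fin n × Fin k → Fin n =>
      ∃ S : Finset (Fin n), S.card = g ∧ (S ×ˢ Finset.univ).image f = S).card * n ^ (g * k) ≤
      Fintype.card (Fin n × Fin k → Fin n) * occCount n (g * k) g := by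
  set N := Fintype.card (Fin n × Fin k → Fin n)
  have single : ∀ S ∈ Finset.powersetCard g (Finset.univ : Finset (Fin n)),
      (Finset.univ.filter fun f : Fin n × Fin k → Fin n =>
        (S ×ˢ Finset.univ).image f = S).card * n ^ (g * k) ≤
      N * (Finset.univ.filter fun h : Fin (g * k) → Fin n => Finset.univ.image h = S).card := by
    intro S hS
    have hcard : (S ×ˢ (Finset.univ : Finset (Fin k))).card = g * k := by
      simp [(Finset.mem_powersetCard.mp hS).2]
    let e : Fin (g * k) ↪ Fin n × Fin k :=
      ((S ×ˢ Finset.univ).equivFinOfCardEq hcard).symm.toEmbedding.trans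
        (Function.Embedding.subtype _)
    have he : Finset.univ.image e = S ×ˢ Finset.univ := by
      ext x
      simp only [Finset.mem_image, Finset.mem_univ, true_and]
      constructor
      · rintro ⟨i, rfl⟩
        exact (((S ×ˢ Finset.univ).equivFinOfCardEq hcard).symm i).2
      · intro hx
        exact ⟨(S ×ˢ Finset.univ).equivFinOfCardEq hcard ⟨x, hx⟩, by simp [e]⟩
    have := card_comp_mem_mul_le e
      (Finset.univ.filter fun h : Fin (g * k) → Fin n => Finset.univ.image h = S)
    simpa [← Finset.image_image, he, N] using this
  have hsub : (Finset.univ.filter fun f : Fin n × Fin k → Fin n =>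
      ∃ S : Finset (Fin n), S.card = g ∧ (S ×ˢ Finset.univ).image f = S) ⊆
      (Finset.powersetCard g Finset.univ).biUnion fun S =>
        Finset.univ.filter fun f => (S ×ˢ Finset.univ).image f = S := by
    intro f hf
    obtain ⟨S, hS, hfS⟩ := (Finset.mem_filter.mp hf).2
    simp only [Finset.mem_biUnion, Finset.mem_powersetCard]
    exact ⟨S, ⟨Finset.subset_univ _, hS⟩, by simpa using hfS⟩
  calc _ ≤ (∑ S ∈ Finset.powersetCard g (Finset.univ : Finset (Fin n)),
          (Finset.univ.filter fun f : Fin n × Fin k → Fin n =>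
            (S ×ˢ Finset.univ).image f = S).card) * n ^ (g * k) :=
        Nat.mul_le_mul_right _ ((Finset.card_le_card hsub).trans Finset.card_biUnion_le)
    _ ≤ N * ∑ S ∈ Finset.powersetCard g (Finset.univ : Finset (Fin n)),
          (Finset.univ.filter fun h : Fin (g * k) → Fin n => Finset.univ.image h = S).card := by
        rw [Finset.sum_mul, Finset.mul_sum]
        exact Finset.sum_le_sum single
    _ = N * occCount n (g * k) g := by
        congr 1
        rw [occCount, Finset.card_eq_sum_card_fiberwise
          (f := fun h : Fin (g * k) → Fin n => Finset.univ.image h)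
          (t := Finset.powersetCard g (Finset.univ : Finset (Fin n)))]
        · refine Finset.sum_congr rfl fun S hS => ?_
          congr 1
          ext h
          simp only [Finset.mem_filter, Finset.mem_univ, true_and]
          exact ⟨fun H => ⟨H ▸ (Finset.mem_powersetCard.mp hS).2, H⟩, fun H => H.2⟩
        · intro h hh
          simpa using hh

/-- A rooted vertex set `Q ⊆ A` all of whose non-root vertices have an in-arc from `Q`, and whose
induced subdigraph has more arcs than vertices. -/
def HasDenseRootedSubset {n k : ℕ} (A : Finset (Fin n)) (f : Fin n × Fin k → Fin n) : Prop :=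
  ∃ Q ⊆ A, ∃ r ∈ Q, (∀ w ∈ Q.erase r, ∃ s : Fin n × Fin k, s.1 ∈ Q ∧ f s = w) ∧
    Q.card + 1 ≤ (Finset.univ.filter fun s : Fin n × Fin k => s.1 ∈ Q ∧ f s ∈ Q).card

/-- A dense rooted set carries `|Q| + 1` distinct arcs whose heads are the non-root vertices
and two further vertices of `Q`. -/
theorem exists_embedding_of_dense {n k : ℕ} (Q : Finset (Fin n)) (r : Fin n) (hr : r ∈ Q)
    (f : Fin n × Fin k → Fin n)
    (hin : ∀ w ∈ Q.erase r, ∃ s : Fin n × Fin k, s.1 ∈ Q ∧ f s = w)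
    (hcard : Q.card + 1 ≤
      (Finset.univ.filter fun s : Fin n × Fin k => s.1 ∈ Q ∧ f s ∈ Q).card) :
    ∃ (e : ({w // w ∈ Q.erase r} ⊕ Fin 2) ↪ {s : Fin n × Fin k // s ∈ Q ×ˢ Finset.univ})
      (y : Fin 2 → {w // w ∈ Q}),
      f ∘ (e.trans (Function.Embedding.subtype _)) =
        Sum.elim (fun w : {w // w ∈ Q.erase r} => (w : Fin n)) (fun i => (y i : Fin n)) := by
  have : Nonempty (Fin n × Fin k) := by
    obtain ⟨x, -⟩ := Finset.card_pos.mp ((Nat.succ_pos _).trans_le hcard)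
    exact ⟨x⟩
  choose! s hsQ hs using hin
  set T := Finset.univ.filter fun s : Fin n × Fin k => s.1 ∈ Q ∧ f s ∈ Q
  have hlt : 1 < (T \ (Q.erase r).image s).card := by
    have h1 : ((Q.erase r).image s).card ≤ Q.card - 1 :=
      Finset.card_image_le.trans (Finset.card_erase_of_mem hr).le
    have h2 := Finset.le_card_sdiff ((Q.erase r).image s) T
    have h3 : 0 < Q.card := Finset.card_pos.mpr ⟨r, hr⟩
    omega
  obtain ⟨a, ha, b, hb, hab⟩ := Finset.one_lt_card.mp hlt
  simp only [T, Finset.mem_sdiff, Finset.mem_filter, Finset.mem_univ, true_and, Finset.mem_image,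
    not_exists, not_and] at ha hb
  let e0 : ({w // w ∈ Q.erase r} ⊕ Fin 2) → {s : Fin n × Fin k // s ∈ Q ×ˢ Finset.univ} :=
    Sum.elim (fun w => ⟨s w, by simpa using hsQ w w.2⟩)
      ![⟨a, by simpa using ha.1.1⟩, ⟨b, by simpa using hb.1.1⟩]
  have he0 : Function.Injective e0 := by
    rintro (u | i) (v | j) h
    · have h' : s u = s v := congrArg Subtype.val h
      have : f (s u) = f (s v) := by rw [h']
      rw [hs u u.2, hs v v.2] at this
      rw [Subtype.ext this]
    · exfalso
      fin_cases j
      · exact ha.2 u u.2 (congrArg Subtype.val h)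
      · exact hb.2 u u.2 (congrArg Subtype.val h)
    · exfalso
      fin_cases i
      · exact ha.2 v v.2 (congrArg Subtype.val h).symm
      · exact hb.2 v v.2 (congrArg Subtype.val h).symm
    · have h' := congrArg Subtype.val h
      fin_cases i <;> fin_cases j
      · rfl
      · exact absurd h' hab
      · exact absurd h'.symm hab
      · rfl
  refine ⟨⟨e0, he0⟩, ![⟨f a, ha.1.2⟩, ⟨f b, hb.1.2⟩], funext ?_⟩
  rintro (w | i)
  · exact hs w w.2
  · fin_cases i <;> rfl

/-- Union bound over cylinder events indexed by embeddings and prescribed values. -/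
theorem card_exists_embedding_mul_le {ι τ σ V P : Type*} [Fintype ι] [Fintype τ] [Fintype σ]
    [Fintype V] [Fintype P] [DecidableEq σ] (i : τ ↪ σ) (y : P → ι → V)
    (E : Finset (σ → V)) (hE : ∀ f ∈ E, ∃ (e : ι ↪ τ) (p : P), f ∘ (e.trans i) = y p) :
    E.card * Fintype.card V ^ Fintype.card ι ≤
      Fintype.card (σ → V) *
        ((Fintype.card τ).descFactorial (Fintype.card ι) * Fintype.card P) := by
  let cyl (x : (ι ↪ τ) × P) : Finset (σ → V) :=
    Finset.univ.filter fun f => f ∘ (x.1.trans i) ∈ ({y x.2} : Finset (ι → V))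
  have hcyl : ∀ x, (cyl x).card * Fintype.card V ^ Fintype.card ι ≤ Fintype.card (σ → V) := by
    intro x
    have := card_comp_mem_mul_le (x.1.trans i) {y x.2}
    rwa [Fintype.card_fun (α := ι), Finset.card_singleton, mul_one] at this
  have hsub : E ⊆ Finset.univ.biUnion cyl := by
    intro f hf
    obtain ⟨e, p, h⟩ := hE f hf
    exact Finset.mem_biUnion.mpr ⟨(e, p), Finset.mem_univ _, by simpa [cyl] using h⟩
  calc _ ≤ (∑ x, (cyl x).card) * Fintype.card V ^ Fintype.card ι :=
        Nat.mul_le_mul_right _ ((Finset.card_le_card hsub).trans Finset.card_biUnion_le)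
    _ ≤ ∑ _x : (ι ↪ τ) × P, Fintype.card (σ → V) := by
        rw [Finset.sum_mul]
        exact Finset.sum_le_sum fun x _ => hcyl x
    _ = _ := by
        rw [Finset.sum_const, Finset.card_univ, Fintype.card_prod, smul_eq_mul, mul_comm,
          Fintype.card_embedding_eq]

/-- The number of functions for which a fixed rooted set `(Q, r)` is dense. -/
theorem card_dense_rooted_mul_le {n k : ℕ} (Q : Finset (Fin n)) (r : Fin n) (hr : r ∈ Q) :
    (Finset.univ.filter fun f : Fin n × Fin k → Fin n =>
      (∀ w ∈ Q.erase r, ∃ s : Fin n × Fin k, s.1 ∈ Q ∧ f s = w) ∧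
      Q.card + 1 ≤ (Finset.univ.filter fun s : Fin n × Fin k => s.1 ∈ Q ∧ f s ∈ Q).card).card *
        n ^ (Q.card + 1) ≤
      Fintype.card (Fin n × Fin k → Fin n) *
        (2 ^ (Q.card * k) * (Q.card + 1).factorial * Q.card ^ 2) := by
  let ι := {w // w ∈ Q.erase r} ⊕ Fin 2
  let slot := {s : Fin n × Fin k // s ∈ Q ×ˢ (Finset.univ : Finset (Fin k))}
  have hι : Fintype.card ι = Q.card + 1 := by
    have h3 : 0 < Q.card := Finset.card_pos.mpr ⟨r, hr⟩
    simp only [ι, Fintype.card_sum, Fintype.card_coe, Fintype.card_fin,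
      Finset.card_erase_of_mem hr]
    omega
  have hslot : Fintype.card slot = Q.card * k := by
    rw [Fintype.card_coe]
    simp
  have hy : Fintype.card (Fin 2 → {w // w ∈ Q}) = Q.card ^ 2 := by
    rw [Fintype.card_fun, Fintype.card_coe, Fintype.card_fin]
  have hcyl := card_exists_embedding_mul_le
    (Function.Embedding.subtype (· ∈ Q ×ˢ (Finset.univ : Finset (Fin k))))
    (fun (y : Fin 2 → {w // w ∈ Q}) (i : ι) =>
      Sum.elim (fun w : {w // w ∈ Q.erase r} => (w : Fin n)) (fun i => (y i : Fin n)) i)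
    (Finset.univ.filter fun f : Fin n × Fin k → Fin n =>
      (∀ w ∈ Q.erase r, ∃ s : Fin n × Fin k, s.1 ∈ Q ∧ f s = w) ∧
      Q.card + 1 ≤ (Finset.univ.filter fun s : Fin n × Fin k => s.1 ∈ Q ∧ f s ∈ Q).card)
    (fun f hf => by
      obtain ⟨h1, h2⟩ := (Finset.mem_filter.mp hf).2
      exact exists_embedding_of_dense Q r hr f h1 h2)
  rw [hι, hslot, hy, Fintype.card_fin, Nat.descFactorial_eq_factorial_mul_choose] at hcyl
  refine hcyl.trans ?_
  rw [mul_comm (Nat.factorial _)]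
  exact Nat.mul_le_mul_left _ (Nat.mul_le_mul_right _ (Nat.mul_le_mul_right _
    (Nat.choose_le_two_pow _ _)))

/-- First moment bound: dense rooted subsets of a sparse vertex set `A` are unlikely. -/
theorem card_hasDenseRootedSubset_le {n k : ℕ} (hn : 1 ≤ n) (A : Finset (Fin n)) (b : ℝ)
    (hA : (A.card : ℝ) ≤ b * n) (hb : 0 ≤ b) (hb1 : 2 ^ k * b < 1) :
    ((Finset.univ.filter fun f : Fin n × Fin k → Fin n => HasDenseRootedSubset A f).card : ℝ) ≤
      Fintype.card (Fin n × Fin k → Fin n) *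
        ((∑' q : ℕ, (q : ℝ) ^ 3 * (q + 1) * (2 ^ k * b) ^ q) / n) := by
  set N := Fintype.card (Fin n × Fin k → Fin n)
  have hn0 : (0 : ℝ) < n := by exact_mod_cast hn
  let ev (Q : Finset (Fin n)) (r : Fin n) : Finset (Fin n × Fin k → Fin n) :=
    Finset.univ.filter fun f => (∀ w ∈ Q.erase r, ∃ s : Fin n × Fin k, s.1 ∈ Q ∧ f s = w) ∧
      Q.card + 1 ≤ (Finset.univ.filter fun s : Fin n × Fin k => s.1 ∈ Q ∧ f s ∈ Q).card
  let w (q : ℕ) : ℝ := N * (q * (2 ^ (q * k) * (q + 1).factorial * q ^ 2) / n ^ (q + 1))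
  have hsub : (Finset.univ.filter fun f : Fin n × Fin k → Fin n => HasDenseRootedSubset A f) ⊆
      A.powerset.biUnion fun Q => Q.biUnion fun r => ev Q r := by
    intro f hf
    obtain ⟨Q, hQ, r, hr, h⟩ := (Finset.mem_filter.mp hf).2
    simp only [Finset.mem_biUnion, Finset.mem_powerset]
    exact ⟨Q, hQ, r, hr, by simpa [ev] using h⟩
  have hev : ∀ Q : Finset (Fin n), ((Q.biUnion fun r => ev Q r).card : ℝ) ≤ w Q.card := by
    intro Q
    have h1 : ∀ r ∈ Q, ((ev Q r).card : ℝ) ≤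
        N * ((2 ^ (Q.card * k) * (Q.card + 1).factorial * Q.card ^ 2) / n ^ (Q.card + 1)) := by
      intro r hr
      rw [← mul_div_assoc, le_div_iff₀ (by positivity)]
      exact_mod_cast card_dense_rooted_mul_le (k := k) Q r hr
    calc ((Q.biUnion fun r => ev Q r).card : ℝ) ≤ ∑ r ∈ Q, ((ev Q r).card : ℝ) := by
          exact_mod_cast Finset.card_biUnion_le
      _ ≤ _ := Finset.sum_le_sum h1
      _ = w Q.card := by
          rw [Finset.sum_const, nsmul_eq_mul]
          simp only [w]
          ring
  have hβ : 0 ≤ 2 ^ k * b := by positivity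
  have hsum : Summable fun q : ℕ => (q : ℝ) ^ 3 * (q + 1) * (2 ^ k * b) ^ q := by
    have h4 := summable_pow_mul_geometric_of_norm_lt_one (R := ℝ) 4 (r := 2 ^ k * b)
      (by rwa [Real.norm_of_nonneg hβ])
    have h3 := summable_pow_mul_geometric_of_norm_lt_one (R := ℝ) 3 (r := 2 ^ k * b)
      (by rwa [Real.norm_of_nonneg hβ])
    exact (h4.add h3).congr fun q => by ring
  have hterm : ∀ q : ℕ, (A.card.choose q : ℝ) * w q ≤
      N * (((q : ℝ) ^ 3 * (q + 1) * (2 ^ k * b) ^ q) / n) := by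
    intro q
    have h1 : (A.card.choose q : ℝ) * q.factorial ≤ (b * n) ^ q := by
      have h2 : A.card.choose q * q.factorial ≤ A.card ^ q := by
        rw [mul_comm, ← Nat.descFactorial_eq_factorial_mul_choose]
        exact Nat.descFactorial_le_pow _ _
      calc (A.card.choose q : ℝ) * q.factorial ≤ (A.card : ℝ) ^ q := by exact_mod_cast h2
        _ ≤ _ := by gcongr
    calc (A.card.choose q : ℝ) * w q
        = (A.card.choose q * q.factorial) *
          (N * (q ^ 3 * (q + 1) * 2 ^ (q * k) / n ^ (q + 1))) := by
          simp only [w, Nat.factorial_succ]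
          push_cast
          ring
      _ ≤ (b * n) ^ q * (N * (q ^ 3 * (q + 1) * 2 ^ (q * k) / n ^ (q + 1))) := by gcongr
      _ = _ := by
          rw [mul_pow, mul_pow, ← pow_mul, mul_comm k q]
          field_simp
          ring
  calc ((Finset.univ.filter fun f : Fin n × Fin k → Fin n =>
        HasDenseRootedSubset A f).card : ℝ)
      ≤ ∑ Q ∈ A.powerset, ((Q.biUnion fun r => ev Q r).card : ℝ) := by
        exact_mod_cast (Finset.card_le_card hsub).trans Finset.card_biUnion_le
    _ ≤ ∑ Q ∈ A.powerset, w Q.card := Finset.sum_le_sum fun Q _ => hev Q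
    _ = ∑ q ∈ Finset.range (A.card + 1), (A.card.choose q : ℝ) * w q := by
        rw [Finset.sum_powerset_apply_card]
        simp
    _ ≤ ∑ q ∈ Finset.range (A.card + 1),
          N * (((q : ℝ) ^ 3 * (q + 1) * (2 ^ k * b) ^ q) / n) :=
        Finset.sum_le_sum fun q _ => hterm q
    _ = N * ((∑ q ∈ Finset.range (A.card + 1),
          (q : ℝ) ^ 3 * (q + 1) * (2 ^ k * b) ^ q) / n) := by
        rw [← Finset.mul_sum, Finset.sum_div]
    _ ≤ _ := by
        gcongr
        exact hsum.sum_le_tsum _ fun q _ => by positivity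

section Structure

variable {n k : ℕ}

theorem IsClosedSet.reaches_mem {f : Fin n × Fin k → Fin n} {S : Set (Fin n)}
    (hS : IsClosedSet f S) {u v : Fin n} (hu : u ∈ S) (h : Reaches f u v) : v ∈ S := by
  induction h with
  | refl => exact hu
  | tail _ hstep ih =>
    obtain ⟨i, rfl⟩ := hstep
    exact hS _ ih i

/-- Every vertex of a closed strongly connected set is hit by an arc of that set. -/
theorem image_eq_of_isStrConn (hk : 0 < k) {f : Fin n × Fin k → Fin n} {S : Finset (Fin n)}
    (hS : IsClosedSet f S) (hc : IsStrConn f S) :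
    (S ×ˢ Finset.univ).image f = S := by
  apply Finset.Subset.antisymm
  · intro w hw
    obtain ⟨⟨u, i⟩, hs, rfl⟩ := Finset.mem_image.mp hw
    exact hS u (Finset.mem_product.mp hs).1 i
  · intro w hw
    have hw' : f (w, ⟨0, hk⟩) ∈ (S : Set (Fin n)) := hS w hw _
    simp only [Finset.mem_image, Finset.mem_product, Finset.mem_univ, and_true, Prod.exists]
    rcases Relation.ReflTransGen.cases_tail (hc.2 _ hw' _ hw) with h | ⟨u, hu, i, hi⟩
    · exact ⟨w, _, hw, h.symm⟩
    · exact ⟨u, i, hS.reaches_mem hw' hu, hi⟩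

theorem isClosedSet_isStrConn_of_agree {f f' : Fin n × Fin k → Fin n} {S : Finset (Fin n)}
    (h : ∀ s ∈ S ×ˢ Finset.univ, f s = f' s) (hf : IsClosedSet f S ∧ IsStrConn f S) :
    IsClosedSet f' S ∧ IsStrConn f' S := by
  obtain ⟨hcl, hne, hreach⟩ := hf
  have hagree : ∀ v ∈ S, ∀ i, f (v, i) = f' (v, i) := fun v hv i => h _ (by simpa using hv)
  refine ⟨fun v hv i => hagree v hv i ▸ hcl v hv i, hne, fun u hu v hv => ?_⟩
  have key : ∀ w, Reaches f u w → Reaches f' u w := by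
    intro w hw
    induction hw with
    | refl => exact Relation.ReflTransGen.refl
    | tail hab hstep ih =>
      obtain ⟨i, rfl⟩ := hstep
      exact ih.tail ⟨i, (hagree _ (hcl.reaches_mem hu hab) i).symm⟩
  exact key v (hreach u hu v hv)

theorem hasDenseRootedSubset_of_agree {f f' : Fin n × Fin k → Fin n} {S : Finset (Fin n)}
    (h : ∀ s ∉ S ×ˢ Finset.univ, f s = f' s) (hf : HasDenseRootedSubset Sᶜ f) :
    HasDenseRootedSubset Sᶜ f' := by
  obtain ⟨Q, hQ, r, hr, hin, hcard⟩ := hf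
  have hagree : ∀ s : Fin n × Fin k, s.1 ∈ Q → f s = f' s := fun s hs =>
    h s (by simpa using Finset.mem_compl.mp (hQ hs))
  refine ⟨Q, hQ, r, hr, fun w hw => ?_, hcard.trans (Finset.card_le_card fun s hs => ?_)⟩
  · obtain ⟨s, hs, hw⟩ := hin w hw
    exact ⟨s, hs, hagree s hs ▸ hw⟩
  · simp only [Finset.mem_filter, Finset.mem_univ, true_and] at hs ⊢
    exact ⟨hs.1, hagree s hs.1 ▸ hs.2⟩

theorem hasDenseRootedSubset_of_specIn {f : Fin n × Fin k → Fin n} {A : Finset (Fin n)}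
    {v : Fin n} (hv : v ∈ A) (h : (specIn f A v).ncard + 1 ≤ numArcs f (specIn f A v)) :
    HasDenseRootedSubset A f := by
  refine ⟨(specIn f A v).toFinset, fun w hw => (Set.mem_toFinset.mp hw).1, v,
    Set.mem_toFinset.mpr ⟨hv, Relation.ReflTransGen.refl⟩, fun w hw => ?_, ?_⟩
  · obtain ⟨hne, hw⟩ := Finset.mem_erase.mp hw
    obtain ⟨-, hreach⟩ := Set.mem_toFinset.mp hw
    rcases Relation.ReflTransGen.cases_tail hreach with h | ⟨u, hu, huA, -, i, hi⟩
    · exact absurd h hne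
    · exact ⟨(u, i), Set.mem_toFinset.mpr ⟨huA, hu⟩, hi⟩
  · rw [Set.ncard_eq_toFinset_card'] at h
    simpa [numArcs] using h

/-- Two closed strongly connected sets that meet coincide. -/
theorem subset_of_isStrConn {f : Fin n × Fin k → Fin n} {S T : Set (Fin n)}
    (hS : IsStrConn f S) (hT : IsClosedSet f T) (h : (S ∩ T).Nonempty) : S ⊆ T := by
  obtain ⟨x, hxS, hxT⟩ := h
  exact fun u hu => hT.reaches_mem hxT (hS.2 x hxS u hu)

/-- In expectation there is at most one closed strongly connected set of size above `n / 2`. -/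
theorem sum_card_closed_strConn_le (𝓢 : Finset (Finset (Fin n)))
    (h𝓢 : ∀ S ∈ 𝓢, n < 2 * S.card) :
    ∑ S ∈ 𝓢, (Finset.univ.filter fun f : Fin n × Fin k → Fin n =>
      IsClosedSet f S ∧ IsStrConn f S).card ≤ Fintype.card (Fin n × Fin k → Fin n) := by
  have hswap := Finset.sum_card_bipartiteAbove_eq_sum_card_bipartiteBelow (s := 𝓢)
    (t := (Finset.univ : Finset (Fin n × Fin k → Fin n)))
    (fun (S : Finset (Fin n)) f => IsClosedSet f (S : Set (Fin n)) ∧ IsStrConn f (S : Set (Fin n)))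
  unfold Finset.bipartiteAbove Finset.bipartiteBelow at hswap
  rw [hswap, ← Finset.card_univ, Finset.card_eq_sum_ones]
  refine Finset.sum_le_sum fun f _ => Finset.card_le_one.mpr fun S hS T hT => ?_
  obtain ⟨hS, hScl, hSc⟩ := Finset.mem_filter.mp hS
  obtain ⟨hT, hTcl, hTc⟩ := Finset.mem_filter.mp hT
  have hmeet : (S ∩ T).Nonempty := by
    rw [← Finset.card_pos]
    have h1 := Finset.card_union_add_card_inter S T
    have h2 : (S ∪ T).card ≤ n := by simpa using Finset.card_le_univ (S ∪ T)
    have h3 := h𝓢 S hS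
    have h4 := h𝓢 T hT
    omega
  have hmeet' : ((S : Set (Fin n)) ∩ T).Nonempty := by exact_mod_cast hmeet
  refine Finset.Subset.antisymm ?_ ?_
  · exact_mod_cast subset_of_isStrConn hSc hTcl hmeet'
  · exact_mod_cast subset_of_isStrConn hTc hScl (Set.inter_comm _ _ ▸ hmeet')

end Structure

/-- A density threshold that is exceeded by the giant and whose complement is subcritical. -/
theorem exists_density_threshold (k : ℕ) (hk : 2 ≤ k) :
    ∃ c : ℝ, 1 / 2 < c ∧ c < 1 ∧ 2 ^ k * (1 - c) < 1 ∧ c < 1 - Real.exp (-(k * c)) := by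
  set c₀ : ℝ := 1 - (2 ^ k)⁻¹ with hc₀
  have hpow : ((2 : ℝ) ^ k)⁻¹ ≤ 1 / 4 := by
    have : (2 : ℝ) ^ 2 ≤ 2 ^ k := pow_le_pow_right₀ (by norm_num) hk
    rw [inv_le_comm₀ (by positivity) (by norm_num)]
    linarith
  have hk0 : (0 : ℝ) < k := by exact_mod_cast (by omega : 0 < k)
  have h0 : c₀ < 1 - Real.exp (-(k * c₀)) := by
    have : Real.exp (-(k * c₀)) < (2 ^ k)⁻¹ := by
      rw [← Real.lt_log_iff_exp_lt (by positivity), Real.log_inv, Real.log_pow]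
      have := Real.log_two_lt_d9
      have : Real.log 2 < c₀ := by linarith
      nlinarith
    linarith
  have hcont : ContinuousAt (fun c : ℝ => 1 - Real.exp (-(k * c)) - c) c₀ := by fun_prop
  have hev : ∀ᶠ c in nhdsWithin c₀ (Set.Ioi c₀), 0 < 1 - Real.exp (-(k * c)) - c :=
    (hcont.eventually_const_lt (by linarith)).filter_mono nhdsWithin_le_nhds
  obtain ⟨c, hc, hcc⟩ := (hev.and self_mem_nhdsWithin).exists
  have hcc : c₀ < c := hcc
  refine ⟨c, by linarith, ?_, ?_, by linarith⟩
  · have := Real.exp_pos (-(k * c))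
    linarith
  · have h1 : 1 - c < (2 ^ k)⁻¹ := by linarith
    calc (2 : ℝ) ^ k * (1 - c) < 2 ^ k * (2 ^ k)⁻¹ := by gcongr
      _ = 1 := mul_inv_cancel₀ (by positivity)

theorem one_add_mul_exp_neg_lt_one {η : ℝ} (hη : 0 < η) : (1 + η) * Real.exp (-η) < 1 := by
  have h := Real.add_one_lt_exp hη.ne'
  rw [Real.exp_neg, ← div_eq_mul_inv, div_lt_one (Real.exp_pos _)]
  linarith

/-- The expected number of closed sets of size `g` with all vertices hit, for `1 ≤ g ≤ c n`,
is at most geometrically small in `g`, uniformly in `n`. -/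
theorem exists_occCount_geometric (k : ℕ) (c : ℝ) (hc0 : 0 < c) (hc1 : c < 1)
    (hc : c < 1 - Real.exp (-(k * c))) :
    ∃ ρ : ℝ, 0 ≤ ρ ∧ ρ < 1 ∧ ∀ n g : ℕ, 1 ≤ n → (g : ℝ) ≤ c * n →
      (occCount n (g * k) g : ℝ) / (n : ℝ) ^ (g * k) ≤ ρ ^ g := by
  set x := Real.exp (-(k * c)) with hx
  set η := (1 - x) / c - 1 with hη
  have hη0 : 0 < η := by
    rw [hη, sub_pos, lt_div_iff₀ hc0]
    linarith
  refine ⟨(1 + η) * Real.exp (-η), by positivity, one_add_mul_exp_neg_lt_one hη0, ?_⟩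
  intro n g hn hg
  have hn0 : (0 : ℝ) < n := by exact_mod_cast hn
  have hgn : g ≤ n := by
    have : (g : ℝ) ≤ n := hg.trans (by nlinarith)
    exact_mod_cast this
  refine occCount_div_le n (g * k) g hn hgn η hη0.le ?_
  set a : ℝ := g / (c * n) with ha
  have ha0 : 0 ≤ a := by positivity
  have ha1 : a ≤ 1 := (div_le_one (by positivity)).mpr hg
  have hconv := convexOn_exp.2 (Set.mem_univ (0 : ℝ)) (Set.mem_univ (-(k * c)))
    (sub_nonneg.mpr ha1) ha0 (by ring)
  simp only [smul_eq_mul, mul_zero, zero_add, Real.exp_zero, mul_one] at hconv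
  have harg : a * -(k * c) = -(((g * k : ℕ) : ℝ) / n) := by
    rw [ha]; push_cast; field_simp
  rw [harg] at hconv
  have hη' : (1 + η) * g = n * (a * (1 - x)) := by
    rw [hη, ha]; field_simp; ring
  rw [hη']
  gcongr
  linarith

/-- Some spectrum outside the giant induces more arcs than it has vertices. -/
def HasDenseSpectrum {n k : ℕ} (f : Fin n × Fin k → Fin n) : Prop :=
  ∃ G : Set (Fin n), IsGiant f G ∧
    ∃ v : Fin n, v ∉ G ∧ (specIn f Gᶜ v).ncard + 1 ≤ numArcs f (specIn f Gᶜ v)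

theorem card_hasDenseSpectrum_le {n k : ℕ} (hk : 2 ≤ k) (hn : 1 ≤ n) (c : ℝ) (hc : 1 / 2 < c) (hc1 : c < 1)
    (hc2 : 2 ^ k * (1 - c) < 1) :
    ((Finset.univ.filter fun f : Fin n × Fin k → Fin n => HasDenseSpectrum f).card : ℝ) ≤
      Fintype.card (Fin n × Fin k → Fin n) *
        ((∑ g ∈ (Finset.range (n + 1)).filter (fun g : ℕ => 1 ≤ g ∧ (g : ℝ) ≤ c * n),
          (occCount n (g * k) g : ℝ) / (n : ℝ) ^ (g * k)) +
        (∑' q : ℕ, (q : ℝ) ^ 3 * (q + 1) * (2 ^ k * (1 - c)) ^ q) / n) := by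
  have : NeZero n := ⟨by omega⟩
  set N := Fintype.card (Fin n × Fin k → Fin n) with hN
  have hn0 : (0 : ℝ) < n := by exact_mod_cast hn
  have hN0 : (0 : ℝ) < N := by exact_mod_cast Fintype.card_pos
  set K := ∑' q : ℕ, (q : ℝ) ^ 3 * (q + 1) * (2 ^ k * (1 - c)) ^ q with hK
  let I := (Finset.range (n + 1)).filter fun g : ℕ => 1 ≤ g ∧ (g : ℝ) ≤ c * n
  let 𝓢 := (Finset.univ : Finset (Finset (Fin n))).filter fun S => c * n < S.card
  let small (g : ℕ) : Finset (Fin n × Fin k → Fin n) := Finset.univ.filter fun f =>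
    ∃ S : Finset (Fin n), S.card = g ∧ (S ×ˢ Finset.univ).image f = S
  let closed (S : Finset (Fin n)) : Finset (Fin n × Fin k → Fin n) :=
    Finset.univ.filter fun f => IsClosedSet f S ∧ IsStrConn f S
  let large (S : Finset (Fin n)) : Finset (Fin n × Fin k → Fin n) := Finset.univ.filter fun f =>
    (IsClosedSet f S ∧ IsStrConn f S) ∧ HasDenseRootedSubset Sᶜ f
  have hsub : (Finset.univ.filter fun f : Fin n × Fin k → Fin n => HasDenseSpectrum f) ⊆
      I.biUnion small ∪ 𝓢.biUnion large := by
    intro f hf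
    obtain ⟨G, hG, v, hv, hbad⟩ := (Finset.mem_filter.mp hf).2
    obtain ⟨S, rfl⟩ : ∃ S : Finset (Fin n), (S : Set (Fin n)) = G := ⟨G.toFinset, by simp⟩
    obtain ⟨hcl, hsc, -⟩ := hG
    simp only [Finset.mem_union, Finset.mem_biUnion]
    rcases le_or_gt ((S.card : ℝ)) (c * n) with hle | hlt
    · left
      refine ⟨S.card, ?_, ?_⟩
      · have h1 : S.card ≤ n := by simpa using Finset.card_le_univ S
        have h2 : 0 < S.card := Finset.card_pos.mpr (by exact_mod_cast hsc.1)
        simp only [I, Finset.mem_filter, Finset.mem_range]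
        exact ⟨by omega, h2, hle⟩
      · simp only [small, Finset.mem_filter, Finset.mem_univ, true_and]
        exact ⟨S, rfl, image_eq_of_isStrConn (by omega) hcl hsc⟩
    · right
      refine ⟨S, by simpa [𝓢] using hlt, ?_⟩
      simp only [large, Finset.mem_filter, Finset.mem_univ, true_and]
      refine ⟨⟨hcl, hsc⟩, hasDenseRootedSubset_of_specIn (v := v) (by simpa using hv) ?_⟩
      rwa [Finset.coe_compl]
  have hsmall : ∀ g, ((small g).card : ℝ) ≤
      N * ((occCount n (g * k) g : ℝ) / (n : ℝ) ^ (g * k)) := by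
    intro g
    rw [← mul_div_assoc, le_div_iff₀ (by positivity)]
    exact_mod_cast card_exists_image_eq_mul_le n k g
  have hlarge : ∀ S ∈ 𝓢, ((large S).card : ℝ) ≤ (closed S).card * (K / n) := by
    intro S hS
    have hS : c * n < S.card := by simpa [𝓢] using hS
    have hind := card_filter_and_mul_card (V := Fin n)
      (S ×ˢ (Finset.univ : Finset (Fin k)))
      (fun f => IsClosedSet f S ∧ IsStrConn f S) (fun f => HasDenseRootedSubset Sᶜ f)
      (fun f f' h => isClosedSet_isStrConn_of_agree h)
      (fun f f' h => hasDenseRootedSubset_of_agree h)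
    have hA : ((Sᶜ.card : ℕ) : ℝ) ≤ (1 - c) * n := by
      rw [Finset.card_compl, Fintype.card_fin,
        Nat.cast_sub (by simpa using Finset.card_le_univ S)]
      linarith
    have hdense := card_hasDenseRootedSubset_le (k := k) hn Sᶜ (1 - c) hA (by linarith) hc2
    have hind' : ((large S).card : ℝ) * N = (closed S).card *
        ((Finset.univ.filter fun f : Fin n × Fin k → Fin n =>
          HasDenseRootedSubset Sᶜ f).card : ℝ) := by
      have : (large S).card * N = (closed S).card *
          (Finset.univ.filter fun f : Fin n × Fin k → Fin n =>
            HasDenseRootedSubset Sᶜ f).card := by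
        convert hind
      exact_mod_cast this
    refine le_of_mul_le_mul_right ?_ hN0
    rw [hind']
    calc _ ≤ ((closed S).card : ℝ) * (N * (K / n)) := by gcongr
      _ = _ := by ring
  have hclosed : ∑ S ∈ 𝓢, ((closed S).card : ℝ) ≤ N := by
    have := sum_card_closed_strConn_le (k := k) 𝓢 (by
      intro S hS
      have hS : c * n < S.card := by simpa [𝓢] using hS
      have : (n : ℝ) < 2 * S.card := by nlinarith
      exact_mod_cast this)
    exact_mod_cast this
  have hK0 : 0 ≤ K := by
    have : 0 ≤ 1 - c := by linarith
    exact tsum_nonneg fun q => by positivity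
  calc _ ≤ ∑ g ∈ I, ((small g).card : ℝ) + ∑ S ∈ 𝓢, ((large S).card : ℝ) := by
        exact_mod_cast (Finset.card_le_card hsub).trans ((Finset.card_union_le _ _).trans
          (add_le_add Finset.card_biUnion_le Finset.card_biUnion_le))
    _ ≤ ∑ g ∈ I, N * ((occCount n (g * k) g : ℝ) / (n : ℝ) ^ (g * k)) +
          ∑ S ∈ 𝓢, ((closed S).card : ℝ) * (K / n) :=
        add_le_add (Finset.sum_le_sum fun g _ => hsmall g) (Finset.sum_le_sum hlarge)
    _ ≤ ∑ g ∈ I, N * ((occCount n (g * k) g : ℝ) / (n : ℝ) ^ (g * k)) + N * (K / n) := by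
        rw [← Finset.sum_mul]
        gcongr
    _ = _ := by rw [← Finset.mul_sum, mul_add]

/-- Whp every spectrum outside the giant induces a digraph with at most one more arc
than vertices minus one, i.e. `P(∃ v ∉ 𝒢, arc(𝒟[Q*(v)]) - |Q*(v)| ≥ 1) → 0`. -/
theorem spectra_outside_giant_treelike (k : ℕ) (hk : 2 ≤ k) :
    Filter.Tendsto (fun n : ℕ =>
      prob n k (fun f => ∃ G : Set (Fin n), IsGiant f G ∧
        ∃ v : Fin n, v ∉ G ∧ (specIn f Gᶜ v).ncard + 1 ≤ numArcs f (specIn f Gᶜ v)))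
      Filter.atTop (nhds 0) := by
  obtain ⟨c, hc, hc1, hc2, hc3⟩ := exists_density_threshold k hk
  obtain ⟨ρ, hρ0, hρ1, hρ⟩ := exists_occCount_geometric k c (by linarith) hc1 hc3
  let F (n g : ℕ) : ℝ := if 1 ≤ g ∧ (g : ℝ) ≤ c * n then
    (occCount n (g * k) g : ℝ) / (n : ℝ) ^ (g * k) else 0
  have hF0 : ∀ n g, 0 ≤ F n g := fun n g => by
    simp only [F]
    split_ifs <;> positivity
  have hFρ : ∀ n, 1 ≤ n → ∀ g, F n g ≤ ρ ^ g := fun n hn g => by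
    simp only [F]
    split_ifs with h
    · exact hρ n g hn h.2
    · positivity
  have hgeom : Summable fun g : ℕ => ρ ^ g := summable_geometric_of_lt_one hρ0 hρ1
  have hFlim : Tendsto (fun n => ∑' g, F n g) atTop (nhds 0) := by
    have := tendsto_tsum_of_dominated_convergence (𝓕 := atTop) (f := F) (g := fun _ => (0 : ℝ))
      hgeom ?_ ?_
    · simpa using this
    · intro g
      rcases Nat.eq_zero_or_pos g with rfl | hg
      · simp [F]
      · refine squeeze_zero (fun n => hF0 n g) (fun n => ?_) (tendsto_occCount_div k g hk hg)
        simp only [F]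
        split_ifs
        · exact le_rfl
        · positivity
    · filter_upwards [eventually_ge_atTop 1] with n hn g
      rw [Real.norm_of_nonneg (hF0 n g)]
      exact hFρ n hn g
  have hKlim := tendsto_const_div_atTop_nhds_zero_nat
    (∑' q : ℕ, (q : ℝ) ^ 3 * (q + 1) * (2 ^ k * (1 - c)) ^ q)
  have hlim := hFlim.add hKlim
  rw [add_zero] at hlim
  refine squeeze_zero' (Eventually.of_forall fun n => by unfold prob; positivity) ?_ hlim
  filter_upwards [eventually_ge_atTop 1] with n hn
  have : NeZero n := ⟨by omega⟩
  have hN0 : (0 : ℝ) < Fintype.card (Fin n × Fin k → Fin n) := by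
    exact_mod_cast Fintype.card_pos
  rw [prob, div_le_iff₀' hN0]
  refine (card_hasDenseSpectrum_le hk hn c hc hc1 hc2).trans ?_
  gcongr
  rw [Finset.sum_filter]
  exact (hgeom.of_nonneg_of_le (hF0 n) (hFρ n hn)).sum_le_tsum _ fun g _ => hF0 n g
end
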